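/- Let A be a bialgebra and M, N left-right Hopf modules over A. Define C^{n,p}(M,N) = Hom(A^{⊗n}⊗M, N⊗A^{⊗p}), with horizontal face maps b_i and vertical coface maps c_j given by: b_0(f)(a^1⊗...⊗a^{n+1}⊗m) = Σ (a^1)_1·f(a^2⊗...⊗a^{n+1}⊗m)^0 ⊗ (a^1)_2 f(...)^1 ⊗...⊗ (a^1)_{p+1} f(...)^p; b_i multiplies a^i a^{i+1} for 1≤i≤n; b_{n+1}(f)(a^1⊗...⊗a^{n+1}⊗m) = f(a^1⊗...⊗a^n⊗a^{n+1}·m); c_0(f) applies ρ_N to the N-component of the output; c_j applies Δ to the j-th A-output for 1≤j≤p; c_{p+1}(f)(a^1⊗...⊗a^n⊗m) = Σ f((a^1)_1⊗...⊗(a^n)_1⊗m_0) ⊗ (a^1)_2...(a^n)_2 m_1. Then with d_m = Σ(-1)^i b_i and d_c = Σ(-1)^j c_j, (C^{n,p}(M,N), d_m, d_c) is a double complex: d_m² = 0, d_c² = 0, and d_c∘d_m = d_m∘d_c. -/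

import Mathlib

open TensorProduct
noncomputable section

namespace PS

variable (k : Type) [Field k] (A : Type) [Ring A] [Bialgebra k A]

/-- Left-nested tensor powers with base `B`: `pwr B n = B ⊗ A ⊗ ⋯ ⊗ A` (`n` copies of `A`). -/
def pwr (B : ModuleCat k) : ℕ → ModuleCat k
  | 0 => B
  | n + 1 => ModuleCat.of k (pwr B n ⊗[k] A)

/-- `A^{⊗ n}` realized as `pwr k n`, i.e. `k ⊗ A ⊗ ⋯ ⊗ A`. -/
abbrev Pk (n : ℕ) : ModuleCat k := pwr k A (ModuleCat.of k k) n

abbrev μA : A ⊗[k] A →ₗ[k] A := LinearMap.mul' k A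
abbrev ΔA : A →ₗ[k] A ⊗[k] A := Coalgebra.comul
abbrev εA : A →ₗ[k] k := Coalgebra.counit

/-- Multiplication of the tensorands in slots `i` and `i+1` (`1 ≤ i ≤ n`);
junk (zero map) for other `i`. -/
def mulP : (n : ℕ) → (i : ℕ) → ((Pk k A (n+1) : Type) →ₗ[k] Pk k A n)
  | 0, _ => 0
  | n + 1, i =>
      if i = n + 1 then
        (TensorProduct.map (LinearMap.id : (Pk k A n : Type) →ₗ[k] Pk k A n) (μA k A)).comp
          (TensorProduct.assoc k (Pk k A n) A A).toLinearMap
      else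
        TensorProduct.map (mulP n i) (LinearMap.id : A →ₗ[k] A)

/-- Insert an `A`-factor at the innermost slot (slot 1). -/
def insP : (n : ℕ) → (A ⊗[k] (Pk k A n : Type)) ≃ₗ[k] (Pk k A (n+1) : Type)
  | 0 => TensorProduct.comm k A k
  | n + 1 =>
      (TensorProduct.assoc k A (Pk k A n) A).symm.trans
        (TensorProduct.congr (insP n) (LinearEquiv.refl k A))

section NM

variable {N : Type} [AddCommGroup N] [Module k N]

/-- The left diagonal action of `A` on `N ⊗ A^{⊗ p}` built from a base action `ωN`. -/
def ldiag (ωN : A ⊗[k] N →ₗ[k] N) :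
    (p : ℕ) → (A ⊗[k] (pwr k A (ModuleCat.of k N) p : Type) →ₗ[k] pwr k A (ModuleCat.of k N) p)
  | 0 => ωN
  | p + 1 =>
      (TensorProduct.map (ldiag ωN p) (μA k A)).comp <|
        ((TensorProduct.tensorTensorTensorComm k A A
            (pwr k A (ModuleCat.of k N) p : Type) A).toLinearMap).comp
          (TensorProduct.map (ΔA k A) (LinearMap.id :
            ((pwr k A (ModuleCat.of k N) p : Type) ⊗[k] A) →ₗ[k] _))

/-- Right diagonal multiplication on the `A`-slots of `N ⊗ A^{⊗ p}` (counit on the base). -/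
def rdiagE : (p : ℕ) →
    ((pwr k A (ModuleCat.of k N) p : Type) ⊗[k] A →ₗ[k] pwr k A (ModuleCat.of k N) p)
  | 0 => (TensorProduct.rid k N).toLinearMap.comp
      (TensorProduct.map (LinearMap.id : N →ₗ[k] N) (εA k A))
  | p + 1 =>
      (TensorProduct.map (rdiagE p) (μA k A)).comp <|
        ((TensorProduct.tensorTensorTensorComm k
            (pwr k A (ModuleCat.of k N) p : Type) A A A).toLinearMap).comp
          (TensorProduct.map
            (LinearMap.id : ((pwr k A (ModuleCat.of k N) p : Type) ⊗[k] A) →ₗ[k] _) (ΔA k A))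

/-- Right diagonal action on `N ⊗ A^{⊗ p}` built from a base (right) action `ωNr`. -/
def rdiagAct (ωNr : N ⊗[k] A →ₗ[k] N) : (p : ℕ) →
    ((pwr k A (ModuleCat.of k N) p : Type) ⊗[k] A →ₗ[k] pwr k A (ModuleCat.of k N) p)
  | 0 => ωNr
  | p + 1 =>
      (TensorProduct.map (rdiagAct ωNr p) (μA k A)).comp <|
        ((TensorProduct.tensorTensorTensorComm k
            (pwr k A (ModuleCat.of k N) p : Type) A A A).toLinearMap).comp
          (TensorProduct.map
            (LinearMap.id : ((pwr k A (ModuleCat.of k N) p : Type) ⊗[k] A) →ₗ[k] _) (ΔA k A))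

end NM

/-- `dL : A^{⊗ n} → A ⊗ A^{⊗ n}`, `a^1 ⊗ ⋯ ⊗ a^n ↦ Σ (a^1)_1 ⋯ (a^n)_1 ⊗ ((a^1)_2 ⊗ ⋯ ⊗ (a^n)_2)`. -/
def dL : (n : ℕ) → ((Pk k A n : Type) →ₗ[k] A ⊗[k] (Pk k A n : Type))
  | 0 => (TensorProduct.map (Algebra.linearMap k A) (LinearMap.id : k →ₗ[k] k)).comp
      (TensorProduct.lid k k).symm.toLinearMap
  | n + 1 =>
      (TensorProduct.map (μA k A)
          (LinearMap.id : ((Pk k A n : Type) ⊗[k] A) →ₗ[k] _)).comp <|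
        ((TensorProduct.tensorTensorTensorComm k A (Pk k A n : Type) A A).toLinearMap).comp
          (TensorProduct.map (dL n) (ΔA k A))

/-- `dR : A^{⊗ n} → A^{⊗ n} ⊗ A`, `a^1 ⊗ ⋯ ⊗ a^n ↦ Σ ((a^1)_1 ⊗ ⋯ ⊗ (a^n)_1) ⊗ (a^1)_2 ⋯ (a^n)_2`. -/
def dR : (n : ℕ) → ((Pk k A n : Type) →ₗ[k] (Pk k A n : Type) ⊗[k] A)
  | 0 => (TensorProduct.map (LinearMap.id : k →ₗ[k] k) (Algebra.linearMap k A)).comp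
      (TensorProduct.rid k k).symm.toLinearMap
  | n + 1 =>
      (TensorProduct.map
          (LinearMap.id : ((Pk k A n : Type) ⊗[k] A) →ₗ[k] _) (μA k A)).comp <|
        ((TensorProduct.tensorTensorTensorComm k (Pk k A n : Type) A A A).toLinearMap).comp
          (TensorProduct.map (dR n) (ΔA k A))

section Base

variable {N : Type} [AddCommGroup N] [Module k N]

/-- Apply `ρN : N → N ⊗ A` to the base of `N ⊗ A^{⊗ p}`. -/
def rhoBase (ρN : N →ₗ[k] N ⊗[k] A) : (p : ℕ) →
    ((pwr k A (ModuleCat.of k N) p : Type) →ₗ[k] pwr k A (ModuleCat.of k (N ⊗[k] A)) p)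
  | 0 => ρN
  | p + 1 => TensorProduct.map (rhoBase ρN p) (LinearMap.id : A →ₗ[k] A)

/-- Reinterpret `(N ⊗ A) ⊗ A^{⊗ p}` as `N ⊗ A^{⊗ (p+1)}`. -/
def shiftB : (p : ℕ) →
    ((pwr k A (ModuleCat.of k (N ⊗[k] A)) p : Type) ≃ₗ[k] pwr k A (ModuleCat.of k N) (p+1))
  | 0 => LinearEquiv.refl k (N ⊗[k] A)
  | p + 1 => TensorProduct.congr (shiftB p) (LinearEquiv.refl k A)

/-- Multiply the `A`-component of the base `N ⊗ A` on the right by an element of `A`. -/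
def rmulBase : (p : ℕ) →
    ((pwr k A (ModuleCat.of k (N ⊗[k] A)) p : Type) ⊗[k] A →ₗ[k]
      pwr k A (ModuleCat.of k (N ⊗[k] A)) p)
  | 0 => (TensorProduct.map (LinearMap.id : N →ₗ[k] N) (μA k A)).comp
      (TensorProduct.assoc k N A A).toLinearMap
  | p + 1 =>
      (TensorProduct.map (rmulBase p) (LinearMap.id : A →ₗ[k] A)).comp <|
        ((TensorProduct.assoc k (pwr k A (ModuleCat.of k (N ⊗[k] A)) p : Type) A A).symm.toLinearMap).comp <|
          (TensorProduct.map
            (LinearMap.id : (pwr k A (ModuleCat.of k (N ⊗[k] A)) p : Type) →ₗ[k] _)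
            (TensorProduct.comm k A A).toLinearMap).comp
            (TensorProduct.assoc k
              (pwr k A (ModuleCat.of k (N ⊗[k] A)) p : Type) A A).toLinearMap

/-- Apply the counit to the `A`-component of the base `N ⊗ A`. -/
def epsBase : (p : ℕ) →
    ((pwr k A (ModuleCat.of k (N ⊗[k] A)) p : Type) →ₗ[k] pwr k A (ModuleCat.of k N) p)
  | 0 => (TensorProduct.rid k N).toLinearMap.comp
      (TensorProduct.map (LinearMap.id : N →ₗ[k] N) (εA k A))
  | p + 1 => TensorProduct.map (epsBase p) (LinearMap.id : A →ₗ[k] A)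

/-- Apply `Δ` on the `i`-th `A`-slot (`1 ≤ i ≤ p`) of `N ⊗ A^{⊗ p}`; junk otherwise. -/
def comulAt : (p : ℕ) → (i : ℕ) →
    ((pwr k A (ModuleCat.of k N) p : Type) →ₗ[k] pwr k A (ModuleCat.of k N) (p+1))
  | 0, _ => 0
  | p + 1, i =>
      if i = p + 1 then
        ((TensorProduct.assoc k (pwr k A (ModuleCat.of k N) p : Type) A A).symm.toLinearMap).comp
          (TensorProduct.map
            (LinearMap.id : (pwr k A (ModuleCat.of k N) p : Type) →ₗ[k] _) (ΔA k A))
      else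
        TensorProduct.map (comulAt p i) (LinearMap.id : A →ₗ[k] A)

/-- Left coaction on `N ⊗ A^{⊗ p}` coming from a left coaction on the base. -/
def lcoBase (ρNl : N →ₗ[k] A ⊗[k] N) : (p : ℕ) →
    ((pwr k A (ModuleCat.of k N) p : Type) →ₗ[k]
      A ⊗[k] (pwr k A (ModuleCat.of k N) p : Type))
  | 0 => ρNl
  | p + 1 =>
      ((TensorProduct.assoc k A (pwr k A (ModuleCat.of k N) p : Type) A).toLinearMap).comp
        (TensorProduct.map (lcoBase ρNl p) (LinearMap.id : A →ₗ[k] A))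

end Base

section Bicomplex

variable {M N : Type} [AddCommGroup M] [Module k M] [AddCommGroup N] [Module k N]

/-- `A^{⊗ n} ⊗ M`, the domain of the `(n,p)` cochains. -/
abbrev Dm (M : Type) [AddCommGroup M] [Module k M] (n : ℕ) : Type :=
  (Pk k A n : Type) ⊗[k] M

/-- `N ⊗ A^{⊗ p}`. -/
abbrev Cd (N : Type) [AddCommGroup N] [Module k N] (p : ℕ) : Type :=
  (pwr k A (ModuleCat.of k N) p : Type)

/-- The space of `(n,p)` cochains `Hom(A^{⊗ n} ⊗ M, N ⊗ A^{⊗ p})`. -/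
abbrev Yc (M N : Type) [AddCommGroup M] [Module k M] [AddCommGroup N] [Module k N]
    (n p : ℕ) : Type := Dm k A M n →ₗ[k] Cd k A N p

variable (ωM : A ⊗[k] M →ₗ[k] M) (ρM : M →ₗ[k] M ⊗[k] A)
variable (ωN : A ⊗[k] N →ₗ[k] N) (ρN : N →ₗ[k] N ⊗[k] A)

/-- `b_0`: the face using the diagonal left action of `a^1` on `N ⊗ A^{⊗ p}`. -/
def face0 (n p : ℕ) (f : Yc k A M N n p) : Yc k A M N (n+1) p :=
  (ldiag k A ωN p).comp <|
    (TensorProduct.map (LinearMap.id : A →ₗ[k] A) f).comp <|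
      ((TensorProduct.assoc k A (Pk k A n : Type) M).toLinearMap).comp
        (TensorProduct.map (insP k A n).symm.toLinearMap (LinearMap.id : M →ₗ[k] M))

/-- `b_i`, `1 ≤ i ≤ n`: multiply the adjacent arguments `a^i a^{i+1}`. -/
def faceMid (n p : ℕ) (i : ℕ) (f : Yc k A M N n p) : Yc k A M N (n+1) p :=
  f.comp (TensorProduct.map (mulP k A n i) (LinearMap.id : M →ₗ[k] M))

/-- `b_{n+1}` in the Hopf-module case: `f(a^1 ⊗ ⋯ ⊗ a^n ⊗ a^{n+1}·m)`. -/
def faceLastH (n p : ℕ) (f : Yc k A M N n p) : Yc k A M N (n+1) p :=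
  f.comp <|
    (TensorProduct.map (LinearMap.id : (Pk k A n : Type) →ₗ[k] _) ωM).comp
      (TensorProduct.assoc k (Pk k A n : Type) A M).toLinearMap

/-- `b_{n+1}` in the Yetter-Drinfel'd case. -/
def faceLastYD (n p : ℕ) (f : Yc k A M N n p) : Yc k A M N (n+1) p :=
  (rdiagE k A p).comp <|
    ((TensorProduct.comm k A (Cd k A N p)).toLinearMap).comp <|
      (TensorProduct.map (LinearMap.id : A →ₗ[k] A)
        (f.comp (TensorProduct.map (LinearMap.id : (Pk k A n : Type) →ₗ[k] _) ωM))).comp <|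
        ((TensorProduct.leftComm k (Pk k A n : Type) A (A ⊗[k] M)).toLinearMap).comp <|
          (TensorProduct.map (LinearMap.id : (Pk k A n : Type) →ₗ[k] _)
            (TensorProduct.assoc k A A M).toLinearMap).comp <|
            ((TensorProduct.assoc k (Pk k A n : Type) (A ⊗[k] A) M).toLinearMap).comp
              (TensorProduct.map
                (TensorProduct.map (LinearMap.id : (Pk k A n : Type) →ₗ[k] _) (ΔA k A))
                (LinearMap.id : M →ₗ[k] M))

/-- The Yetter-Drinfel'd horizontal faces `b_i^{n,p}`, `0 ≤ i ≤ n+1`. -/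
def bYD (n p : ℕ) (i : ℕ) (f : Yc k A M N n p) : Yc k A M N (n+1) p :=
  if i = 0 then face0 k A ωN n p f
  else if i ≤ n then faceMid k A n p i f
  else faceLastYD k A ωM n p f

/-- The Hopf-module horizontal faces `b_i^{n,p}`, `0 ≤ i ≤ n+1`. -/
def bH (n p : ℕ) (i : ℕ) (f : Yc k A M N n p) : Yc k A M N (n+1) p :=
  if i = 0 then face0 k A ωN n p f
  else if i ≤ n then faceMid k A n p i f
  else faceLastH k A ωM n p f

/-- `c_0` in the Hopf-module case: apply `ρ_N` to the `N`-component of the output. -/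
def cof0H (n p : ℕ) (f : Yc k A M N n p) : Yc k A M N n (p+1) :=
  ((shiftB k A p).toLinearMap).comp ((rhoBase k A ρN p).comp f)

/-- `c_0` in the Yetter-Drinfel'd case. -/
def cof0YD (n p : ℕ) (f : Yc k A M N n p) : Yc k A M N n (p+1) :=
  ((shiftB k A p).toLinearMap).comp <|
    (rmulBase k A p).comp <|
      ((TensorProduct.comm k A
          (pwr k A (ModuleCat.of k (N ⊗[k] A)) p : Type)).toLinearMap).comp <|
        (TensorProduct.map (LinearMap.id : A →ₗ[k] A) ((rhoBase k A ρN p).comp f)).comp <|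
          ((TensorProduct.assoc k A (Pk k A n : Type) M).toLinearMap).comp
            (TensorProduct.map (dL k A n) (LinearMap.id : M →ₗ[k] M))

/-- `c_{p+1}`: uses the right comodule structure of `M`. -/
def cofLast (n p : ℕ) (f : Yc k A M N n p) : Yc k A M N n (p+1) :=
  (TensorProduct.map f (μA k A)).comp <|
    ((TensorProduct.tensorTensorTensorComm k (Pk k A n : Type) A M A).toLinearMap).comp
      (TensorProduct.map (dR k A n) ρM)

/-- The Yetter-Drinfel'd vertical cofaces `c_j^{n,p}`, `0 ≤ j ≤ p+1`. -/
def cYD (n p : ℕ) (j : ℕ) (f : Yc k A M N n p) : Yc k A M N n (p+1) :=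
  if j = 0 then cof0YD k A ρN n p f
  else if j ≤ p then (comulAt k A p j).comp f
  else cofLast k A ρM n p f

/-- The Hopf-module vertical cofaces `c_j^{n,p}`, `0 ≤ j ≤ p+1`. -/
def cH (n p : ℕ) (j : ℕ) (f : Yc k A M N n p) : Yc k A M N n (p+1) :=
  if j = 0 then cof0H k A ρN n p f
  else if j ≤ p then (comulAt k A p j).comp f
  else cofLast k A ρM n p f

/-- The horizontal differential (Yetter-Drinfel'd case). -/
def dmYD (n p : ℕ) (f : Yc k A M N n p) : Yc k A M N (n+1) p :=
  ∑ i ∈ Finset.range (n+2), ((-1 : ℤ)^i) • bYD k A ωM ωN n p i f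

/-- The vertical differential (Yetter-Drinfel'd case). -/
def dcYD (n p : ℕ) (f : Yc k A M N n p) : Yc k A M N n (p+1) :=
  ∑ j ∈ Finset.range (p+2), ((-1 : ℤ)^j) • cYD k A ρM ρN n p j f

/-- The horizontal differential (Hopf-module case). -/
def dmH (n p : ℕ) (f : Yc k A M N n p) : Yc k A M N (n+1) p :=
  ∑ i ∈ Finset.range (n+2), ((-1 : ℤ)^i) • bH k A ωM ωN n p i f

/-- The vertical differential (Hopf-module case). -/
def dcH (n p : ℕ) (f : Yc k A M N n p) : Yc k A M N n (p+1) :=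
  ∑ j ∈ Finset.range (p+2), ((-1 : ℤ)^j) • cH k A ρM ρN n p j f

end Bicomplex

section Structures

variable {M : Type} [AddCommGroup M] [Module k M]

/-- `(M, ωM)` is a left `A`-module. -/
def IsModule (ωM : A ⊗[k] M →ₗ[k] M) : Prop :=
  (∀ m : M, ωM ((1 : A) ⊗ₜ m) = m) ∧
  ∀ (a b : A) (m : M), ωM (a ⊗ₜ ωM (b ⊗ₜ m)) = ωM ((a * b) ⊗ₜ m)

/-- `(M, ρM)` is a right `A`-comodule. -/
def IsComodule (ρM : M →ₗ[k] M ⊗[k] A) : Prop :=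
  ((TensorProduct.rid k M).toLinearMap.comp
      ((TensorProduct.map (LinearMap.id : M →ₗ[k] M) (εA k A)).comp ρM) = LinearMap.id) ∧
  (TensorProduct.map ρM (LinearMap.id : A →ₗ[k] A)).comp ρM =
    ((TensorProduct.assoc k M A A).symm.toLinearMap).comp
      ((TensorProduct.map (LinearMap.id : M →ₗ[k] M) (ΔA k A)).comp ρM)

/-- The map `a ⊗ m ↦ Σ a_1·m_0 ⊗ a_2 m_1`. -/
def hopfRHS (ωM : A ⊗[k] M →ₗ[k] M) (ρM : M →ₗ[k] M ⊗[k] A) :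
    A ⊗[k] M →ₗ[k] M ⊗[k] A :=
  (TensorProduct.map ωM (μA k A)).comp <|
    ((TensorProduct.tensorTensorTensorComm k A A M A).toLinearMap).comp
      (TensorProduct.map (ΔA k A) ρM)

/-- The map `a ⊗ m ↦ Σ (a_2·m)_0 ⊗ (a_2·m)_1 a_1`. -/
def ydLHS (ωM : A ⊗[k] M →ₗ[k] M) (ρM : M →ₗ[k] M ⊗[k] A) :
    A ⊗[k] M →ₗ[k] M ⊗[k] A :=
  (TensorProduct.map (LinearMap.id : M →ₗ[k] M) (μA k A)).comp <|
    ((TensorProduct.assoc k M A A).toLinearMap).comp <|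
      ((TensorProduct.comm k A (M ⊗[k] A)).toLinearMap).comp <|
        (TensorProduct.map (LinearMap.id : A →ₗ[k] A) (ρM.comp ωM)).comp <|
          ((TensorProduct.assoc k A A M).toLinearMap).comp
            (TensorProduct.map (ΔA k A) (LinearMap.id : M →ₗ[k] M))

/-- `(M, ωM, ρM)` is a left-right Yetter-Drinfel'd module over `A`. -/
def IsYetterDrinfeld (ωM : A ⊗[k] M →ₗ[k] M) (ρM : M →ₗ[k] M ⊗[k] A) : Prop :=
  IsModule k A ωM ∧ IsComodule k A ρM ∧
    ydLHS k A ωM ρM = hopfRHS k A ωM ρM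

/-- `(M, ωM, ρM)` is a left-right Hopf module over `A`. -/
def IsHopfModule (ωM : A ⊗[k] M →ₗ[k] M) (ρM : M →ₗ[k] M ⊗[k] A) : Prop :=
  IsModule k A ωM ∧ IsComodule k A ρM ∧
    ρM.comp ωM = hopfRHS k A ωM ρM

end Structures

section DiagonalCoactions

variable {k : Type} [Field k] {A : Type} [Ring A] [Bialgebra k A]
variable {X Y Z X' Y' : Type} [AddCommGroup X] [Module k X] [AddCommGroup Y] [Module k Y]
  [AddCommGroup Z] [Module k Z] [AddCommGroup X'] [Module k X'] [AddCommGroup Y'] [Module k Y']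

/-- `(x ⊗ a) ⊗ (y ⊗ b) ↦ (x ⊗ y) ⊗ a b`. -/
def mulSnd (k A X Y : Type) [Field k] [Ring A] [Bialgebra k A] [AddCommGroup X] [Module k X]
    [AddCommGroup Y] [Module k Y] : (X ⊗[k] A) ⊗[k] (Y ⊗[k] A) →ₗ[k] (X ⊗[k] Y) ⊗[k] A :=
  (TensorProduct.map (LinearMap.id : X ⊗[k] Y →ₗ[k] _) (μA k A)).comp
    (TensorProduct.tensorTensorTensorComm k X A Y A).toLinearMap

@[simp]
lemma mulSnd_tmul (x : X) (a : A) (y : Y) (b : A) :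
    mulSnd k A X Y ((x ⊗ₜ a) ⊗ₜ (y ⊗ₜ b)) = (x ⊗ₜ y) ⊗ₜ (a * b) := by
  simp [mulSnd]

/-- The diagonal coaction on `X ⊗ Y`. -/
def diagCo (δX : X →ₗ[k] X ⊗[k] A) (δY : Y →ₗ[k] Y ⊗[k] A) :
    X ⊗[k] Y →ₗ[k] (X ⊗[k] Y) ⊗[k] A :=
  (mulSnd k A X Y).comp (TensorProduct.map δX δY)

@[simp]
lemma diagCo_tmul (δX : X →ₗ[k] X ⊗[k] A) (δY : Y →ₗ[k] Y ⊗[k] A) (x : X) (y : Y) :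
    diagCo δX δY (x ⊗ₜ y) = mulSnd k A X Y (δX x ⊗ₜ δY y) := rfl

/-- Coassociativity of a right coaction. -/
def IsCoassoc (δ : X →ₗ[k] X ⊗[k] A) : Prop :=
  ∀ x, TensorProduct.map δ (LinearMap.id : A →ₗ[k] A) (δ x) =
    (TensorProduct.assoc k X A A).symm
      (TensorProduct.map (LinearMap.id : X →ₗ[k] X) (ΔA k A) (δ x))

/-- Compatibility of a linear map with coactions. -/
def IsColinear (δ : X →ₗ[k] X ⊗[k] A) (δ' : X' →ₗ[k] X' ⊗[k] A) (g : X →ₗ[k] X') : Prop :=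
  ∀ x, δ' (g x) = TensorProduct.map g (LinearMap.id : A →ₗ[k] A) (δ x)

lemma map_diagCo_mulSnd (δX : X →ₗ[k] X ⊗[k] A) (δY : Y →ₗ[k] Y ⊗[k] A)
    (s : X ⊗[k] A) (t : Y ⊗[k] A) :
    TensorProduct.map (diagCo δX δY) (LinearMap.id : A →ₗ[k] A) (mulSnd k A X Y (s ⊗ₜ t)) =
      TensorProduct.map (mulSnd k A X Y) (μA k A)
        (TensorProduct.tensorTensorTensorComm k _ A _ A
          (TensorProduct.map δX (LinearMap.id : A →ₗ[k] A) s ⊗ₜ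
            TensorProduct.map δY (LinearMap.id : A →ₗ[k] A) t)) := by
  induction s using TensorProduct.induction_on with
  | zero => simp
  | add s s' hs hs' => simp only [add_tmul, map_add, hs, hs']
  | tmul x a =>
    induction t using TensorProduct.induction_on with
    | zero => simp
    | add t t' ht ht' => simp only [tmul_add, map_add, ht, ht']
    | tmul y b => simp

lemma assoc_symm_comul_mulSnd (s : X ⊗[k] A) (t : Y ⊗[k] A) :
    (TensorProduct.assoc k (X ⊗[k] Y) A A).symm
      (TensorProduct.map (LinearMap.id : X ⊗[k] Y →ₗ[k] _) (ΔA k A)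
        (mulSnd k A X Y (s ⊗ₜ t))) =
      TensorProduct.map (mulSnd k A X Y) (μA k A)
        (TensorProduct.tensorTensorTensorComm k _ A _ A
          ((TensorProduct.assoc k X A A).symm
              (TensorProduct.map (LinearMap.id : X →ₗ[k] X) (ΔA k A) s) ⊗ₜ
            (TensorProduct.assoc k Y A A).symm
              (TensorProduct.map (LinearMap.id : Y →ₗ[k] Y) (ΔA k A) t))) := by
  induction s using TensorProduct.induction_on with
  | zero => simp
  | add s s' hs hs' => simp only [add_tmul, map_add, hs, hs']
  | tmul x a =>
    induction t using TensorProduct.induction_on with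
    | zero => simp
    | add t t' ht ht' => simp only [tmul_add, map_add, ht, ht']
    | tmul y b =>
      simp only [mulSnd_tmul, map_tmul, LinearMap.id_apply, ΔA, Bialgebra.comul_mul]
      generalize Coalgebra.comul (R := k) a = u
      generalize Coalgebra.comul (R := k) b = v
      induction u using TensorProduct.induction_on with
      | zero => simp
      | add u u' hu hu' => simp only [add_mul, tmul_add, add_tmul, map_add, hu, hu']
      | tmul a₁ a₂ =>
        induction v using TensorProduct.induction_on with
        | zero => simp
        | add v v' hv hv' => simp only [mul_add, tmul_add, map_add, hv, hv']
        | tmul b₁ b₂ => simp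

lemma IsCoassoc.diagCo {δX : X →ₗ[k] X ⊗[k] A} {δY : Y →ₗ[k] Y ⊗[k] A}
    (hX : IsCoassoc δX) (hY : IsCoassoc δY) : IsCoassoc (diagCo δX δY) := by
  intro z
  induction z using TensorProduct.induction_on with
  | zero => simp
  | add z z' hz hz' => simp only [map_add, hz, hz']
  | tmul x y =>
    rw [diagCo_tmul, map_diagCo_mulSnd, assoc_symm_comul_mulSnd, hX, hY]

lemma isCoassoc_comul : IsCoassoc (ΔA k A) := by
  intro a
  rw [LinearEquiv.eq_symm_apply]
  exact Coalgebra.coassoc_apply a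

lemma isColinear_id (δ : X →ₗ[k] X ⊗[k] A) : IsColinear δ δ LinearMap.id := by
  intro x
  simp

lemma IsColinear.map {δX : X →ₗ[k] X ⊗[k] A} {δX' : X' →ₗ[k] X' ⊗[k] A}
    {δY : Y →ₗ[k] Y ⊗[k] A} {δY' : Y' →ₗ[k] Y' ⊗[k] A} {g : X →ₗ[k] X'} {h : Y →ₗ[k] Y'}
    (hg : IsColinear δX δX' g) (hh : IsColinear δY δY' h) :
    IsColinear (PS.diagCo δX δY) (PS.diagCo δX' δY') (TensorProduct.map g h) := by
  intro z
  induction z using TensorProduct.induction_on with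
  | zero => simp
  | add z z' hz hz' => simp only [map_add, hz, hz']
  | tmul x y =>
    rw [map_tmul, diagCo_tmul, diagCo_tmul, hg, hh]
    generalize δX x = s
    generalize δY y = t
    induction s using TensorProduct.induction_on with
    | zero => simp
    | add s s' hs hs' => simp only [add_tmul, map_add, hs, hs']
    | tmul x a =>
      induction t using TensorProduct.induction_on with
      | zero => simp
      | add t t' ht ht' => simp only [tmul_add, map_add, ht, ht']
      | tmul y b => simp

lemma IsColinear.congr {δ : X →ₗ[k] X ⊗[k] A} {δ' : X' →ₗ[k] X' ⊗[k] A} {g g' : X →ₗ[k] X'}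
    (hg : IsColinear δ δ' g) (h : g' = g) : IsColinear δ δ' g' :=
  h ▸ hg

lemma IsColinear.comp {X'' : Type} [AddCommGroup X''] [Module k X'']
    {δ : X →ₗ[k] X ⊗[k] A} {δ' : X' →ₗ[k] X' ⊗[k] A} {δ'' : X'' →ₗ[k] X'' ⊗[k] A}
    {h : X' →ₗ[k] X''} {g : X →ₗ[k] X'} (hh : IsColinear δ' δ'' h) (hg : IsColinear δ δ' g) :
    IsColinear δ δ'' (h.comp g) := by
  intro x
  rw [LinearMap.comp_apply, hh, hg, ← LinearMap.comp_apply, ← TensorProduct.map_comp,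
    LinearMap.id_comp]

lemma IsColinear.symm {δ : X →ₗ[k] X ⊗[k] A} {δ' : X' →ₗ[k] X' ⊗[k] A} {e : X ≃ₗ[k] X'}
    (he : IsColinear δ δ' e.toLinearMap) : IsColinear δ' δ e.symm.toLinearMap := by
  intro x
  obtain ⟨x, rfl⟩ := e.surjective x
  have h := he x
  simp only [LinearEquiv.coe_coe] at h ⊢
  rw [h, ← LinearMap.comp_apply, ← TensorProduct.map_comp]
  simp

lemma isColinear_assoc (δX : X →ₗ[k] X ⊗[k] A) (δY : Y →ₗ[k] Y ⊗[k] A)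
    (δZ : Z →ₗ[k] Z ⊗[k] A) :
    IsColinear (diagCo (diagCo δX δY) δZ) (diagCo δX (diagCo δY δZ))
      (TensorProduct.assoc k X Y Z).toLinearMap := by
  intro w
  refine LinearMap.congr_fun (f := (diagCo δX (diagCo δY δZ)).comp
    (TensorProduct.assoc k X Y Z).toLinearMap)
    (g := (TensorProduct.map (TensorProduct.assoc k X Y Z).toLinearMap LinearMap.id).comp
      (diagCo (diagCo δX δY) δZ)) (TensorProduct.ext_threefold fun x y z ↦ ?_) w
  simp only [LinearMap.comp_apply, LinearEquiv.coe_coe, assoc_tmul, diagCo_tmul]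
  generalize δX x = s
  generalize δY y = t
  generalize δZ z = u
  induction s using TensorProduct.induction_on with
  | zero => simp
  | add s s' hs hs' => simp only [add_tmul, map_add, hs, hs']
  | tmul x a =>
    induction t using TensorProduct.induction_on with
    | zero => simp
    | add t t' ht ht' => simp only [tmul_add, add_tmul, map_add, ht, ht']
    | tmul y b =>
      induction u using TensorProduct.induction_on with
      | zero => simp
      | add u u' hu hu' => simp only [tmul_add, map_add, hu, hu']
      | tmul z c => simp [mul_assoc]

lemma isColinear_mul : IsColinear (diagCo (ΔA k A) (ΔA k A)) (ΔA k A) (μA k A) := by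
  intro z
  induction z using TensorProduct.induction_on with
  | zero => simp
  | add z z' hz hz' => simp only [map_add, hz, hz']
  | tmul a b =>
    simp only [LinearMap.mul'_apply, ΔA, Bialgebra.comul_mul, diagCo_tmul]
    generalize Coalgebra.comul (R := k) a = u
    generalize Coalgebra.comul (R := k) b = v
    induction u using TensorProduct.induction_on with
    | zero => simp
    | add u u' hu hu' => simp only [add_mul, add_tmul, map_add, hu, hu']
    | tmul a₁ a₂ =>
      induction v using TensorProduct.induction_on with
      | zero => simp
      | add v v' hv hv' => simp only [mul_add, tmul_add, map_add, hv, hv']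
      | tmul b₁ b₂ => simp

lemma isColinear_comm {δ : X →ₗ[k] X ⊗[k] A} (hδ : ∀ x, δ x = x ⊗ₜ 1)
    (δY : Y →ₗ[k] Y ⊗[k] A) :
    IsColinear (diagCo δY δ) (diagCo δ δY) (TensorProduct.comm k Y X).toLinearMap := by
  intro z
  induction z using TensorProduct.induction_on with
  | zero => simp
  | add z z' hz hz' => simp only [map_add, hz, hz']
  | tmul y x =>
    simp only [LinearEquiv.coe_coe, comm_tmul, diagCo_tmul, hδ]
    generalize δY y = t
    induction t using TensorProduct.induction_on with
    | zero => simp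
    | add t t' ht ht' => simp only [tmul_add, add_tmul, map_add, ht, ht']
    | tmul y b => simp

lemma IsCoassoc.of_trivial {δ : X →ₗ[k] X ⊗[k] A} (hδ : ∀ x, δ x = x ⊗ₜ 1) : IsCoassoc δ := by
  intro x
  simp [hδ, Algebra.TensorProduct.one_def]

end DiagonalCoactions

section DiagonalActions

variable {k : Type} [Field k] {A : Type} [Ring A] [Bialgebra k A]
variable {X Y Z X' Y' : Type} [AddCommGroup X] [Module k X] [AddCommGroup Y] [Module k Y]
  [AddCommGroup Z] [Module k Z] [AddCommGroup X'] [Module k X'] [AddCommGroup Y'] [Module k Y']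

/-- The diagonal action on `X ⊗ Y`. -/
def diagAct (α : A ⊗[k] X →ₗ[k] X) (β : A ⊗[k] Y →ₗ[k] Y) :
    A ⊗[k] (X ⊗[k] Y) →ₗ[k] X ⊗[k] Y :=
  (TensorProduct.map α β).comp <|
    ((TensorProduct.tensorTensorTensorComm k A A X Y).toLinearMap).comp
      (TensorProduct.map (ΔA k A) (LinearMap.id : X ⊗[k] Y →ₗ[k] _))

lemma diagAct_tmul (α : A ⊗[k] X →ₗ[k] X) (β : A ⊗[k] Y →ₗ[k] Y) (a : A) (z : X ⊗[k] Y) :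
    diagAct α β (a ⊗ₜ z) =
      TensorProduct.map α β (TensorProduct.tensorTensorTensorComm k A A X Y (ΔA k A a ⊗ₜ z)) :=
  rfl

/-- Associativity of a left action. -/
def IsAssocAct (α : A ⊗[k] X →ₗ[k] X) : Prop :=
  ∀ (a b : A) (x : X), α (a ⊗ₜ α (b ⊗ₜ x)) = α ((a * b) ⊗ₜ x)

/-- Compatibility of a linear map with actions. -/
def IsActLinear (α : A ⊗[k] X →ₗ[k] X) (α' : A ⊗[k] X' →ₗ[k] X') (g : X →ₗ[k] X') : Prop :=
  ∀ (a : A) (x : X), g (α (a ⊗ₜ x)) = α' (a ⊗ₜ g x)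

lemma IsAssocAct.diagAct {α : A ⊗[k] X →ₗ[k] X} {β : A ⊗[k] Y →ₗ[k] Y}
    (hα : IsAssocAct α) (hβ : IsAssocAct β) : IsAssocAct (diagAct α β) := by
  intro a b z
  simp only [diagAct_tmul, ΔA, Bialgebra.comul_mul]
  generalize Coalgebra.comul (R := k) a = u
  generalize Coalgebra.comul (R := k) b = v
  induction z using TensorProduct.induction_on with
  | zero => simp
  | add z z' hz hz' => simp only [tmul_add, map_add, hz, hz']
  | tmul x y =>
    induction u using TensorProduct.induction_on with
    | zero => simp
    | add u u' hu hu' => simp only [add_mul, add_tmul, map_add, hu, hu']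
    | tmul a₁ a₂ =>
      induction v using TensorProduct.induction_on with
      | zero => simp
      | add v v' hv hv' => simp only [mul_add, add_tmul, tmul_add, map_add, hv, hv']
      | tmul b₁ b₂ => simp [hα a₁ b₁ x, hβ a₂ b₂ y]

lemma isAssocAct_mul : IsAssocAct (μA k A) := by
  intro a b c
  simp [mul_assoc]

lemma isActLinear_id (α : A ⊗[k] X →ₗ[k] X) : IsActLinear α α LinearMap.id := fun _ _ ↦ rfl

lemma IsActLinear.map {α : A ⊗[k] X →ₗ[k] X} {α' : A ⊗[k] X' →ₗ[k] X'}
    {β : A ⊗[k] Y →ₗ[k] Y} {β' : A ⊗[k] Y' →ₗ[k] Y'} {g : X →ₗ[k] X'} {h : Y →ₗ[k] Y'}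
    (hg : IsActLinear α α' g) (hh : IsActLinear β β' h) :
    IsActLinear (diagAct α β) (diagAct α' β') (TensorProduct.map g h) := by
  intro a z
  simp only [diagAct_tmul]
  generalize ΔA k A a = u
  induction z using TensorProduct.induction_on with
  | zero => simp
  | add z z' hz hz' => simp only [tmul_add, map_add, hz, hz']
  | tmul x y =>
    induction u using TensorProduct.induction_on with
    | zero => simp
    | add u u' hu hu' => simp only [add_tmul, map_add, hu, hu']
    | tmul a₁ a₂ => simp [hg a₁ x, hh a₂ y]

lemma IsActLinear.congr {α : A ⊗[k] X →ₗ[k] X} {α' : A ⊗[k] X' →ₗ[k] X'} {g g' : X →ₗ[k] X'}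
    (hg : IsActLinear α α' g) (h : g' = g) : IsActLinear α α' g' :=
  h ▸ hg

lemma IsActLinear.comp {X'' : Type} [AddCommGroup X''] [Module k X'']
    {α : A ⊗[k] X →ₗ[k] X} {α' : A ⊗[k] X' →ₗ[k] X'} {α'' : A ⊗[k] X'' →ₗ[k] X''}
    {h : X' →ₗ[k] X''} {g : X →ₗ[k] X'} (hh : IsActLinear α' α'' h) (hg : IsActLinear α α' g) :
    IsActLinear α α'' (h.comp g) := by
  intro a x
  rw [LinearMap.comp_apply, hg, hh, LinearMap.comp_apply]

lemma isActLinear_assoc_symm (α : A ⊗[k] X →ₗ[k] X) (β : A ⊗[k] Y →ₗ[k] Y)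
    (γ : A ⊗[k] Z →ₗ[k] Z) :
    IsActLinear (diagAct α (diagAct β γ)) (diagAct (diagAct α β) γ)
      (TensorProduct.assoc k X Y Z).symm.toLinearMap := by
  intro a w
  let Φ (x : X) (y : Y) (z : Z) : A ⊗[k] (A ⊗[k] A) →ₗ[k] (X ⊗[k] Y) ⊗[k] Z :=
    (TensorProduct.assoc k X Y Z).symm.toLinearMap.comp
      (TensorProduct.map (α.comp ((TensorProduct.mk k A X).flip x))
        (TensorProduct.map (β.comp ((TensorProduct.mk k A Y).flip y))
          (γ.comp ((TensorProduct.mk k A Z).flip z))))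
  have hl (x : X) (y : Y) (z : Z) (u : A ⊗[k] A) :
      (TensorProduct.assoc k X Y Z).symm (TensorProduct.map α (diagAct β γ)
        (TensorProduct.tensorTensorTensorComm k A A X (Y ⊗[k] Z) (u ⊗ₜ (x ⊗ₜ (y ⊗ₜ z))))) =
      Φ x y z ((ΔA k A).lTensor A u) := by
    induction u using TensorProduct.induction_on with
    | zero => simp
    | add u u' hu hu' => simp only [add_tmul, map_add, hu, hu']
    | tmul a b =>
      simp only [tensorTensorTensorComm_tmul, map_tmul, diagAct_tmul, LinearMap.lTensor_tmul]
      generalize ΔA k A b = v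
      induction v using TensorProduct.induction_on with
      | zero => simp
      | add v v' hv hv' => simp only [add_tmul, tmul_add, map_add, hv, hv']
      | tmul b c => simp [Φ]
  have hr (x : X) (y : Y) (z : Z) (u : A ⊗[k] A) :
      TensorProduct.map (diagAct α β) γ
        (TensorProduct.tensorTensorTensorComm k A A (X ⊗[k] Y) Z (u ⊗ₜ ((x ⊗ₜ y) ⊗ₜ z))) =
      Φ x y z (TensorProduct.assoc k A A A ((ΔA k A).rTensor A u)) := by
    induction u using TensorProduct.induction_on with
    | zero => simp
    | add u u' hu hu' => simp only [add_tmul, map_add, hu, hu']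
    | tmul a b =>
      simp only [tensorTensorTensorComm_tmul, map_tmul, diagAct_tmul, LinearMap.rTensor_tmul]
      generalize ΔA k A a = v
      induction v using TensorProduct.induction_on with
      | zero => simp
      | add v v' hv hv' => simp only [add_tmul, map_add, hv, hv']
      | tmul b c => simp [Φ]
  induction w using TensorProduct.induction_on with
  | zero => simp
  | add w w' hw hw' => simp only [tmul_add, map_add, hw, hw']
  | tmul x w =>
    induction w using TensorProduct.induction_on with
    | zero => simp
    | add w w' hw hw' => simp only [tmul_add, map_add, hw, hw']
    | tmul y z =>
      simp only [LinearEquiv.coe_coe, assoc_symm_tmul]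
      rw [diagAct_tmul, diagAct_tmul, hl, hr]
      exact congrArg _ (Coalgebra.coassoc_apply a).symm

lemma isActLinear_comul : IsActLinear (μA k A) (diagAct (μA k A) (μA k A)) (ΔA k A) := by
  intro a b
  simp only [LinearMap.mul'_apply, ΔA, Bialgebra.comul_mul, diagAct_tmul]
  generalize Coalgebra.comul (R := k) a = u
  generalize Coalgebra.comul (R := k) b = v
  induction u using TensorProduct.induction_on with
  | zero => simp
  | add u u' hu hu' => simp only [add_mul, add_tmul, map_add, hu, hu']
  | tmul a₁ a₂ =>
    induction v using TensorProduct.induction_on with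
    | zero => simp
    | add v v' hv hv' => simp only [mul_add, tmul_add, map_add, hv, hv']
    | tmul b₁ b₂ => simp

end DiagonalActions

section TensorPowers

variable {k : Type} [Field k] {A : Type} [Ring A] [Bialgebra k A]

/-- The identification of `B ⊗ A^{⊗ (n+1)}` with `(B ⊗ A^{⊗ n}) ⊗ A`. -/
def snoc (k A : Type) [Field k] [Ring A] [Bialgebra k A] (B : ModuleCat k) (n : ℕ) :
    (pwr k A B n : Type) ⊗[k] A ≃ₗ[k] (pwr k A B (n + 1) : Type) :=
  LinearEquiv.refl k _

/-- The identification of `B ⊗ A^{⊗ (n+2)}` with `(B ⊗ A^{⊗ n}) ⊗ (A ⊗ A)`. -/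
def snocTwo (k A : Type) [Field k] [Ring A] [Bialgebra k A] (B : ModuleCat k) (n : ℕ) :
    (pwr k A B n : Type) ⊗[k] (A ⊗[k] A) →ₗ[k] (pwr k A B (n + 2) : Type) :=
  (snoc k A B (n + 1)).toLinearMap.comp
    ((TensorProduct.map (snoc k A B n).toLinearMap LinearMap.id).comp
      (TensorProduct.assoc k _ A A).symm.toLinearMap)

lemma snocTwo_tmul {B : ModuleCat k} {n : ℕ} (x : pwr k A B n) (a b : A) :
    snocTwo k A B n (x ⊗ₜ (a ⊗ₜ b)) = snoc k A B (n + 1) (snoc k A B n (x ⊗ₜ a) ⊗ₜ b) := rfl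

/-- Induction along the last tensorand of a tensor power. -/
lemma pwr_succ_induction {B : ModuleCat k} {n : ℕ} {C : (pwr k A B (n + 1) : Type) → Prop}
    (zero : C 0) (tmul : ∀ (x : pwr k A B n) (a : A), C (snoc k A B n (x ⊗ₜ a)))
    (add : ∀ x y, C x → C y → C (x + y)) (x : pwr k A B (n + 1)) : C x :=
  TensorProduct.induction_on (motive := C) x zero tmul add

lemma mulP_succ_self (n : ℕ) (x : Pk k A n) (a b : A) :
    mulP k A (n + 1) (n + 1) (snoc k A _ (n + 1) (snoc k A _ n (x ⊗ₜ a) ⊗ₜ b)) =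
      snoc k A _ n (x ⊗ₜ (a * b)) :=
  LinearMap.congr_fun (show mulP k A (n + 1) (n + 1) = _ from if_pos rfl) _

lemma mulP_succ_of_ne {n i : ℕ} (hi : i ≠ n + 1) (x : Pk k A (n + 1)) (a : A) :
    mulP k A (n + 1) i (snoc k A _ (n + 1) (x ⊗ₜ a)) = snoc k A _ n (mulP k A n i x ⊗ₜ a) :=
  LinearMap.congr_fun (show mulP k A (n + 1) i = _ from if_neg hi) _

lemma insP_succ (n : ℕ) (a : A) (x : Pk k A n) (b : A) :
    insP k A (n + 1) (a ⊗ₜ snoc k A _ n (x ⊗ₜ b)) =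
      snoc k A _ (n + 1) (insP k A n (a ⊗ₜ x) ⊗ₜ b) := rfl

lemma mulP_comp_mulP : ∀ (n : ℕ) {i j : ℕ}, 1 ≤ i → i < j → j ≤ n + 1 →
    ∀ x, mulP k A n i (mulP k A (n + 1) j x) = mulP k A n (j - 1) (mulP k A (n + 1) i x)
  | 0, i, j, h1, h2, h3, _ => by omega
  | n + 1, i, j, h1, h2, h3, x => by
    induction x using pwr_succ_induction with
    | zero => simp only [map_zero]
    | add x y hx hy => simp only [map_add, hx, hy]
    | tmul x c =>
      rcases eq_or_ne j (n + 1 + 1) with rfl | hj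
      · rw [Nat.add_sub_cancel]
        induction x using pwr_succ_induction with
        | zero => simp only [zero_tmul, map_zero]
        | add x y hx hy => simp only [add_tmul, map_add, hx, hy]
        | tmul x b =>
          rw [mulP_succ_self, mulP_succ_of_ne (show i ≠ n + 1 + 1 by omega)]
          rcases eq_or_ne i (n + 1) with rfl | hi
          · induction x using pwr_succ_induction with
            | zero => simp only [zero_tmul, map_zero]
            | add x y hx hy => simp only [add_tmul, map_add, hx, hy]
            | tmul x a =>
              rw [mulP_succ_self, mulP_succ_self, mulP_succ_self, mul_assoc]
          · rw [mulP_succ_of_ne hi, mulP_succ_of_ne hi, mulP_succ_self]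
      · rw [mulP_succ_of_ne hj, mulP_succ_of_ne (by omega), mulP_succ_of_ne (by omega),
          mulP_succ_of_ne (by omega), mulP_comp_mulP n h1 h2 (by omega)]

lemma mulP_insP : ∀ (n : ℕ) {j : ℕ}, 2 ≤ j → j ≤ n + 1 → ∀ (a : A) (x : Pk k A (n + 1)),
    mulP k A (n + 1) j (insP k A (n + 1) (a ⊗ₜ x)) = insP k A n (a ⊗ₜ mulP k A n (j - 1) x)
  | 0, j, h1, h2, _, _ => by omega
  | n + 1, j, h1, h2, a, x => by
    induction x using pwr_succ_induction with
    | zero => simp only [tmul_zero, map_zero]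
    | add x y hx hy => simp only [tmul_add, map_add, hx, hy]
    | tmul x c =>
      rw [insP_succ]
      rcases eq_or_ne j (n + 1 + 1) with rfl | hj
      · rw [Nat.add_sub_cancel]
        induction x using pwr_succ_induction with
        | zero => simp only [zero_tmul, tmul_zero, map_zero]
        | add x y hx hy => simp only [add_tmul, tmul_add, map_add, hx, hy]
        | tmul x b => rw [insP_succ, mulP_succ_self, mulP_succ_self, insP_succ]
      · rw [mulP_succ_of_ne hj, mulP_insP n h1 (by omega), mulP_succ_of_ne (by omega), insP_succ]

lemma mulP_one_insP_insP : ∀ (n : ℕ) (a b : A) (x : Pk k A n),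
    mulP k A (n + 1) 1 (insP k A (n + 1) (a ⊗ₜ insP k A n (b ⊗ₜ x))) =
      insP k A n ((a * b) ⊗ₜ x)
  | 0, a, b, x => mulP_succ_self 0 x a b
  | n + 1, a, b, x => by
    induction x using pwr_succ_induction with
    | zero => simp only [tmul_zero, map_zero]
    | add x y hx hy => simp only [tmul_add, map_add, hx, hy]
    | tmul x c =>
      rw [insP_succ, insP_succ, mulP_succ_of_ne (by omega), mulP_one_insP_insP n, insP_succ]

lemma dR_zero (r : Pk k A 0) : dR k A 0 r = r ⊗ₜ (1 : A) :=
  congrArg (fun a ↦ r ⊗ₜ[k] a) (map_one (algebraMap k A))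

lemma isCoassoc_dR : ∀ n : ℕ, IsCoassoc (dR k A n)
  | 0 => IsCoassoc.of_trivial dR_zero
  | n + 1 => IsCoassoc.diagCo (isCoassoc_dR n) isCoassoc_comul

lemma isColinear_insP : ∀ n : ℕ,
    IsColinear (diagCo (ΔA k A) (dR k A n)) (dR k A (n + 1)) (insP k A n).toLinearMap
  | 0 => isColinear_comm dR_zero (ΔA k A)
  | n + 1 =>
    ((isColinear_insP n).map (isColinear_id (ΔA k A))).comp
      (isColinear_assoc (ΔA k A) (dR k A n) (ΔA k A)).symm

lemma isColinear_mulP : ∀ (n : ℕ) {i : ℕ}, 1 ≤ i → i ≤ n →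
    IsColinear (dR k A (n + 1)) (dR k A n) (mulP k A n i)
  | 0, i, h1, h2 => by omega
  | n + 1, i, h1, h2 => by
    rcases eq_or_ne i (n + 1) with rfl | hi
    · exact (((isColinear_id (dR k A n)).map isColinear_mul).comp
        (isColinear_assoc (dR k A n) (ΔA k A) (ΔA k A))).congr (if_pos rfl)
    · exact ((isColinear_mulP n h1 (by omega)).map (isColinear_id (ΔA k A))).congr (if_neg hi)

end TensorPowers

section Coefficients

variable {k : Type} [Field k] {A : Type} [Ring A] [Bialgebra k A]
variable {N : Type} [AddCommGroup N] [Module k N]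

lemma comulAt_succ_self (p : ℕ) (x : Cd k A N p) (a : A) :
    comulAt k A (p + 1) (p + 1) (snoc k A _ p (x ⊗ₜ a)) = snocTwo k A _ p (x ⊗ₜ ΔA k A a) := by
  have hid (z : Cd k A N p ⊗[k] (A ⊗[k] A)) : (TensorProduct.assoc k _ A A).symm z =
      snocTwo k A (ModuleCat.of k N) p z :=
    (LinearMap.congr_fun (TensorProduct.map_id (R := k)) _).symm
  exact (LinearMap.congr_fun (show comulAt k A (p + 1) (p + 1) = _ from if_pos rfl) _).trans
    (hid _)

lemma comulAt_succ_of_ne {p i : ℕ} (hi : i ≠ p + 1) (x : Cd k A N p) (a : A) :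
    comulAt k A (p + 1) i (snoc k A _ p (x ⊗ₜ a)) =
      snoc k A _ (p + 1) (comulAt k A p i x ⊗ₜ a) :=
  LinearMap.congr_fun (show comulAt k A (p + 1) i = _ from if_neg hi) _

lemma comulAt_snocTwo_last (p : ℕ) (x : Cd k A N p) (u : A ⊗[k] A) :
    comulAt k A (p + 2) (p + 2) (snocTwo k A _ p (x ⊗ₜ u)) =
      snocTwo k A _ (p + 1) (TensorProduct.map (snoc k A _ p).toLinearMap LinearMap.id
        ((TensorProduct.assoc k (Cd k A N p) A (A ⊗[k] A)).symm
          (x ⊗ₜ (ΔA k A).lTensor A u))) := by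
  induction u using TensorProduct.induction_on with
  | zero => simp only [tmul_zero, map_zero]
  | add u u' hu hu' => simp only [tmul_add, map_add, hu, hu']
  | tmul b c =>
    rw [snocTwo_tmul, comulAt_succ_self]
    rfl

lemma comulAt_snocTwo_prev (p : ℕ) (x : Cd k A N p) (u : A ⊗[k] A) :
    comulAt k A (p + 2) (p + 1) (snocTwo k A _ p (x ⊗ₜ u)) =
      snocTwo k A _ (p + 1) (TensorProduct.map (snoc k A _ p).toLinearMap LinearMap.id
        ((TensorProduct.assoc k (Cd k A N p) A (A ⊗[k] A)).symm
          (x ⊗ₜ TensorProduct.assoc k A A A ((ΔA k A).rTensor A u)))) := by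
  induction u using TensorProduct.induction_on with
  | zero => simp only [tmul_zero, map_zero]
  | add u u' hu hu' => simp only [tmul_add, map_add, hu, hu']
  | tmul b c =>
    rw [snocTwo_tmul, comulAt_succ_of_ne (by omega), comulAt_succ_self, LinearMap.rTensor_tmul]
    generalize ΔA k A b = v
    induction v using TensorProduct.induction_on with
    | zero => simp only [tmul_zero, zero_tmul, map_zero]
    | add v v' hv hv' => simp only [tmul_add, add_tmul, map_add, hv, hv']
    | tmul b₁ b₂ => rfl

lemma comulAt_snocTwo_of_le {p i : ℕ} (hi : i ≤ p) (x : Cd k A N p) (u : A ⊗[k] A) :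
    comulAt k A (p + 2) i (snocTwo k A _ p (x ⊗ₜ u)) =
      snocTwo k A _ (p + 1) (comulAt k A p i x ⊗ₜ u) := by
  induction u using TensorProduct.induction_on with
  | zero => simp only [tmul_zero, map_zero]
  | add u u' hu hu' => simp only [tmul_add, map_add, hu, hu']
  | tmul b c =>
    rw [snocTwo_tmul, comulAt_succ_of_ne (by omega), comulAt_succ_of_ne (by omega), snocTwo_tmul]

lemma comulAt_comp_comulAt : ∀ (p : ℕ) {i j : ℕ}, 1 ≤ i → i < j → j ≤ p + 1 →
    ∀ x : Cd k A N p, comulAt k A (p + 1) j (comulAt k A p i x) =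
      comulAt k A (p + 1) i (comulAt k A p (j - 1) x)
  | 0, i, j, h1, h2, h3, _ => by omega
  | p + 1, i, j, h1, h2, h3, x => by
    induction x using pwr_succ_induction with
    | zero => simp only [map_zero]
    | add x y hx hy => simp only [map_add, hx, hy]
    | tmul x a =>
      rcases eq_or_ne j (p + 1 + 1) with rfl | hj
      · rw [Nat.add_sub_cancel, comulAt_succ_self]
        rcases eq_or_ne i (p + 1) with rfl | hi
        · rw [comulAt_succ_self, comulAt_snocTwo_last, comulAt_snocTwo_prev,
            ← Coalgebra.coassoc_apply a]
        · rw [comulAt_succ_of_ne hi, comulAt_succ_self, comulAt_snocTwo_of_le (by omega)]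
      · rw [comulAt_succ_of_ne (show i ≠ p + 1 by omega), comulAt_succ_of_ne (by omega),
          comulAt_succ_of_ne (by omega), comulAt_succ_of_ne (by omega),
          comulAt_comp_comulAt p h1 h2 (by omega)]

/-- The coaction of `N` applied to the base of `N ⊗ A^{⊗ p}`. -/
def coactBase (ρN : N →ₗ[k] N ⊗[k] A) (p : ℕ) : Cd k A N p →ₗ[k] Cd k A N (p + 1) :=
  (shiftB k A p).toLinearMap.comp (rhoBase k A ρN p)

lemma coactBase_succ (ρN : N →ₗ[k] N ⊗[k] A) (p : ℕ) (x : Cd k A N p) (a : A) :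
    coactBase ρN (p + 1) (snoc k A _ p (x ⊗ₜ a)) =
      snoc k A _ (p + 1) (coactBase ρN p x ⊗ₜ a) := rfl

lemma coactBase_snocTwo (ρN : N →ₗ[k] N ⊗[k] A) (p : ℕ) (x : Cd k A N p) (u : A ⊗[k] A) :
    coactBase ρN (p + 2) (snocTwo k A _ p (x ⊗ₜ u)) =
      snocTwo k A _ (p + 1) (coactBase ρN p x ⊗ₜ u) := by
  induction u using TensorProduct.induction_on with
  | zero => simp only [tmul_zero, map_zero]
  | add u u' hu hu' => simp only [tmul_add, map_add, hu, hu']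
  | tmul b c => rw [snocTwo_tmul, coactBase_succ, coactBase_succ, snocTwo_tmul]

lemma comulAt_coactBase (ρN : N →ₗ[k] N ⊗[k] A) : ∀ (p : ℕ) {j : ℕ}, 2 ≤ j → j ≤ p + 1 →
    ∀ x : Cd k A N p, comulAt k A (p + 1) j (coactBase ρN p x) =
      coactBase ρN (p + 1) (comulAt k A p (j - 1) x)
  | 0, j, h1, h2, _ => by omega
  | p + 1, j, h1, h2, x => by
    induction x using pwr_succ_induction with
    | zero => simp only [map_zero]
    | add x y hx hy => simp only [map_add, hx, hy]
    | tmul x a =>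
      rw [coactBase_succ]
      rcases eq_or_ne j (p + 1 + 1) with rfl | hj
      · rw [Nat.add_sub_cancel, comulAt_succ_self, comulAt_succ_self, coactBase_snocTwo]
      · rw [comulAt_succ_of_ne (by omega), comulAt_succ_of_ne (by omega), coactBase_succ,
          comulAt_coactBase ρN p h1 (by omega)]

lemma comulAt_one_coactBase {ρN : N →ₗ[k] N ⊗[k] A} (hρ : IsCoassoc ρN) : ∀ (p : ℕ)
    (x : Cd k A N p), comulAt k A (p + 1) 1 (coactBase ρN p x) =
      coactBase ρN (p + 1) (coactBase ρN p x)
  | 0, x => by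
    have hmap : TensorProduct.map ρN (LinearMap.id : A →ₗ[k] A) = coactBase ρN 1 :=
      TensorProduct.ext' fun _ _ ↦ rfl
    exact (LinearMap.congr_fun (show comulAt k A 1 1 = _ from if_pos rfl) _).trans
      ((hρ x).symm.trans (LinearMap.congr_fun hmap _))
  | p + 1, x => by
    induction x using pwr_succ_induction with
    | zero => simp only [map_zero]
    | add x y hx hy => simp only [map_add, hx, hy]
    | tmul x a =>
      rw [coactBase_succ, comulAt_succ_of_ne (by omega), comulAt_one_coactBase hρ p,
        coactBase_succ]

lemma isAssocAct_ldiag {ωN : A ⊗[k] N →ₗ[k] N} (hω : IsAssocAct ωN) : ∀ p : ℕ,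
    IsAssocAct (ldiag k A ωN p)
  | 0 => hω
  | p + 1 => (isAssocAct_ldiag hω p).diagAct isAssocAct_mul

lemma isActLinear_coactBase {ωN : A ⊗[k] N →ₗ[k] N} {ρN : N →ₗ[k] N ⊗[k] A}
    (h : ρN.comp ωN = hopfRHS k A ωN ρN) : ∀ p : ℕ,
    IsActLinear (ldiag k A ωN p) (ldiag k A ωN (p + 1)) (coactBase ρN p)
  | 0 => fun a x ↦ (LinearMap.congr_fun h (a ⊗ₜ x)).trans rfl
  | p + 1 => ((isActLinear_coactBase h p).map (isActLinear_id (μA k A))).congr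
      (TensorProduct.ext' fun x a ↦ coactBase_succ ρN p x a)

lemma isActLinear_comulAt (ωN : A ⊗[k] N →ₗ[k] N) : ∀ (p : ℕ) (j : ℕ), 1 ≤ j → j ≤ p →
    IsActLinear (ldiag k A ωN p) (ldiag k A ωN (p + 1)) (comulAt k A p j)
  | 0, j, h1, h2 => by omega
  | p + 1, j, h1, h2 => by
    rcases eq_or_ne j (p + 1) with rfl | hj
    · exact ((isActLinear_assoc_symm (ldiag k A ωN p) (μA k A) (μA k A)).comp
        ((isActLinear_id (ldiag k A ωN p)).map isActLinear_comul)).congr (if_pos rfl)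
    · exact ((isActLinear_comulAt ωN p j h1 (by omega)).map (isActLinear_id (μA k A))).congr
        (if_neg hj)

end Coefficients

section Faces

variable {k : Type} [Field k] {A : Type} [Ring A] [Bialgebra k A]
variable {M N : Type} [AddCommGroup M] [Module k M] [AddCommGroup N] [Module k N]

/-- The diagonal coaction on `A^{⊗ n} ⊗ M`. -/
def coactArg (ρM : M →ₗ[k] M ⊗[k] A) (n : ℕ) : Dm k A M n →ₗ[k] Dm k A M n ⊗[k] A :=
  diagCo (dR k A n) ρM

/-- The identification of `A ⊗ (A^{⊗ n} ⊗ M)` with `A^{⊗ (n+1)} ⊗ M`. -/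
def consArg (k A M : Type) [Field k] [Ring A] [Bialgebra k A] [AddCommGroup M] [Module k M]
    (n : ℕ) : A ⊗[k] Dm k A M n ≃ₗ[k] Dm k A M (n + 1) :=
  (TensorProduct.assoc k A (Pk k A n) M).symm.trans
    (TensorProduct.congr (insP k A n) (LinearEquiv.refl k M))

/-- The map on arguments inducing the horizontal face `b_i`, `1 ≤ i ≤ n + 1`. -/
def argFace (ωM : A ⊗[k] M →ₗ[k] M) (n i : ℕ) : Dm k A M (n + 1) →ₗ[k] Dm k A M n :=
  if i ≤ n then TensorProduct.map (mulP k A n i) LinearMap.id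
  else (TensorProduct.map (LinearMap.id : Pk k A n →ₗ[k] _) ωM).comp
    ((TensorProduct.assoc k (Pk k A n) A M).toLinearMap.comp
      (TensorProduct.map (snoc k A _ n).symm.toLinearMap LinearMap.id))

/-- The map on values inducing the vertical coface `c_j`, `0 ≤ j ≤ p`. -/
def valFace (ρN : N →ₗ[k] N ⊗[k] A) (p j : ℕ) : Cd k A N p →ₗ[k] Cd k A N (p + 1) :=
  if j = 0 then coactBase ρN p else comulAt k A p j

variable {ωM : A ⊗[k] M →ₗ[k] M} {ρM : M →ₗ[k] M ⊗[k] A}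
variable {ωN : A ⊗[k] N →ₗ[k] N} {ρN : N →ₗ[k] N ⊗[k] A}

lemma consArg_tmul (n : ℕ) (a : A) (x : Pk k A n) (m : M) :
    consArg k A M n (a ⊗ₜ (x ⊗ₜ m)) = insP k A n (a ⊗ₜ x) ⊗ₜ m := rfl

lemma argFace_of_le {n i : ℕ} (hi : i ≤ n) (x : Pk k A (n + 1)) (m : M) :
    argFace ωM n i (x ⊗ₜ m) = mulP k A n i x ⊗ₜ m := by
  rw [argFace, if_pos hi, map_tmul, LinearMap.id_apply]

lemma argFace_last (n : ℕ) (x : Pk k A n) (a : A) (m : M) :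
    argFace ωM n (n + 1) (snoc k A _ n (x ⊗ₜ a) ⊗ₜ m) = x ⊗ₜ ωM (a ⊗ₜ m) := by
  rw [argFace, if_neg (by omega)]
  rfl

lemma argFace_comp_argFace (hω : IsAssocAct ωM) {n i j : ℕ} (h1 : 1 ≤ i) (h2 : i < j)
    (h3 : j ≤ n + 2) (z : Dm k A M (n + 2)) :
    argFace ωM n i (argFace ωM (n + 1) j z) =
      argFace ωM n (j - 1) (argFace ωM (n + 1) i z) := by
  induction z using TensorProduct.induction_on with
  | zero => simp only [map_zero]
  | add z z' hz hz' => simp only [map_add, hz, hz']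
  | tmul x m =>
    rcases eq_or_ne j (n + 1 + 1) with rfl | hj
    · rw [Nat.add_sub_cancel, argFace_of_le (show i ≤ n + 1 by omega)]
      induction x using pwr_succ_induction with
      | zero => simp only [zero_tmul, map_zero]
      | add x y hx hy => simp only [add_tmul, map_add, hx, hy]
      | tmul x a =>
        rw [argFace_last]
        rcases eq_or_ne i (n + 1) with rfl | hi
        · induction x using pwr_succ_induction with
          | zero => simp only [zero_tmul, map_zero]
          | add x y hx hy => simp only [add_tmul, map_add, hx, hy]
          | tmul x b => rw [argFace_last, mulP_succ_self, argFace_last, hω]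
        · rw [mulP_succ_of_ne hi, argFace_last, argFace_of_le (by omega)]
    · rw [argFace_of_le (by omega), argFace_of_le (by omega), argFace_of_le (by omega),
        argFace_of_le (by omega), mulP_comp_mulP n h1 h2 (by omega)]

lemma argFace_consArg {n j : ℕ} (h1 : 2 ≤ j) (h2 : j ≤ n + 2) (a : A) (z : Dm k A M (n + 1)) :
    argFace ωM (n + 1) j (consArg k A M (n + 1) (a ⊗ₜ z)) =
      consArg k A M n (a ⊗ₜ argFace ωM n (j - 1) z) := by
  induction z using TensorProduct.induction_on with
  | zero => simp only [tmul_zero, map_zero]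
  | add z z' hz hz' => simp only [tmul_add, map_add, hz, hz']
  | tmul x m =>
    rw [consArg_tmul]
    rcases eq_or_ne j (n + 1 + 1) with rfl | hj
    · rw [Nat.add_sub_cancel]
      induction x using pwr_succ_induction with
      | zero => simp only [zero_tmul, tmul_zero, map_zero]
      | add x y hx hy => simp only [add_tmul, tmul_add, map_add, hx, hy]
      | tmul x b => rw [insP_succ, argFace_last, argFace_last, consArg_tmul]
    · rw [argFace_of_le (by omega), argFace_of_le (by omega), consArg_tmul,
        mulP_insP n h1 (by omega)]

lemma argFace_one_consArg_consArg (n : ℕ) (a b : A) (z : Dm k A M n) :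
    argFace ωM (n + 1) 1 (consArg k A M (n + 1) (a ⊗ₜ consArg k A M n (b ⊗ₜ z))) =
      consArg k A M n ((a * b) ⊗ₜ z) := by
  induction z using TensorProduct.induction_on with
  | zero => simp only [tmul_zero, map_zero]
  | add z z' hz hz' => simp only [tmul_add, map_add, hz, hz']
  | tmul x m =>
    rw [consArg_tmul, consArg_tmul, argFace_of_le (by omega), mulP_one_insP_insP, consArg_tmul]

lemma isCoassoc_coactArg (hρ : IsCoassoc ρM) (n : ℕ) : IsCoassoc (coactArg ρM n) :=
  (isCoassoc_dR n).diagCo hρ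

lemma isColinear_consArg (n : ℕ) :
    IsColinear (diagCo (ΔA k A) (coactArg ρM n)) (coactArg ρM (n + 1))
      (consArg k A M n).toLinearMap :=
  ((isColinear_insP n).map (isColinear_id ρM)).comp
    (isColinear_assoc (ΔA k A) (dR k A n) ρM).symm

lemma isColinear_argFace (h : ρM.comp ωM = hopfRHS k A ωM ρM) {n i : ℕ} (h1 : 1 ≤ i) :
    IsColinear (coactArg ρM (n + 1)) (coactArg ρM n) (argFace ωM n i) := by
  have hω : IsColinear (diagCo (ΔA k A) ρM) ρM ωM := by
    intro z
    refine (LinearMap.congr_fun h z).trans ?_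
    rw [hopfRHS, ← LinearMap.comp_id ωM, ← LinearMap.id_comp (μA k A), TensorProduct.map_comp]
    simp only [LinearMap.comp_id]
    rfl
  rcases le_or_gt i n with hi | hi
  · exact ((isColinear_mulP n h1 hi).map (isColinear_id ρM)).congr (if_pos hi)
  · refine (((isColinear_id (dR k A n)).map hω).comp
      (isColinear_assoc (dR k A n) (ΔA k A) ρM)).congr
      ((if_neg (by omega : ¬ i ≤ n)).trans ?_)
    exact TensorProduct.ext' fun x m ↦ rfl

lemma valFace_snoc {p j : ℕ} (hj : j ≤ p) (w : Cd k A N p ⊗[k] A) :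
    valFace ρN (p + 1) j (snoc k A _ p w) =
      snoc k A _ (p + 1) (TensorProduct.map (valFace ρN p j) LinearMap.id w) := by
  induction w using TensorProduct.induction_on with
  | zero => simp only [map_zero]
  | add w w' hw hw' => simp only [map_add, hw, hw']
  | tmul x a =>
    rw [valFace, valFace]
    split_ifs with h0
    · exact coactBase_succ ρN p x a
    · exact comulAt_succ_of_ne (by omega) x a

lemma valFace_comp_valFace (hρ : IsCoassoc ρN) {p i j : ℕ} (h1 : i < j) (h2 : j ≤ p + 1)
    (x : Cd k A N p) :
    valFace ρN (p + 1) j (valFace ρN p i x) = valFace ρN (p + 1) i (valFace ρN p (j - 1) x) := by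
  rw [valFace, if_neg (by omega : j ≠ 0)]
  rcases Nat.eq_zero_or_pos i with rfl | hi
  · rw [valFace, if_pos rfl, valFace, if_pos rfl, valFace]
    split_ifs with hj
    · obtain rfl : j = 1 := by omega
      exact comulAt_one_coactBase hρ p x
    · exact comulAt_coactBase ρN p (by omega) h2 x
  · rw [valFace, if_neg hi.ne', valFace, if_neg hi.ne', valFace, if_neg (by omega : j - 1 ≠ 0)]
    exact comulAt_comp_comulAt p hi h1 h2 x

lemma isActLinear_valFace (h : ρN.comp ωN = hopfRHS k A ωN ρN) {p j : ℕ} (hj : j ≤ p) :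
    IsActLinear (ldiag k A ωN p) (ldiag k A ωN (p + 1)) (valFace ρN p j) := by
  rw [valFace]
  split_ifs with h0
  · exact isActLinear_coactBase h p
  · exact isActLinear_comulAt ωN p j (by omega) hj

/-- Two maps out of `A^{⊗ (n+1)} ⊗ M` agreeing on `a ⊗ z` with `z ∈ A^{⊗ n} ⊗ M` are equal. -/
lemma consArg_hom_ext {V : Type} [AddCommGroup V] [Module k V] {n : ℕ}
    {f g : Dm k A M (n + 1) →ₗ[k] V}
    (h : ∀ a z, f (consArg k A M n (a ⊗ₜ z)) = g (consArg k A M n (a ⊗ₜ z))) : f = g := by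
  have hfg : f.comp (consArg k A M n).toLinearMap = g.comp (consArg k A M n).toLinearMap :=
    TensorProduct.ext' h
  refine LinearMap.ext fun z ↦ ?_
  obtain ⟨w, rfl⟩ := (consArg k A M n).surjective z
  exact LinearMap.congr_fun hfg w

lemma bH_zero_consArg (n p : ℕ) (f : Yc k A M N n p) (a : A) (z : Dm k A M n) :
    bH k A ωM ωN n p 0 f (consArg k A M n (a ⊗ₜ z)) = ldiag k A ωN p (a ⊗ₜ f z) := by
  have hz : (TensorProduct.assoc k A (Pk k A n) M)
      (TensorProduct.map (insP k A n).symm.toLinearMap LinearMap.id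
        (consArg k A M n (a ⊗ₜ z))) = a ⊗ₜ z := by
    induction z using TensorProduct.induction_on with
    | zero => simp only [tmul_zero, map_zero]
    | add z z' hz hz' => simp only [tmul_add, map_add, hz, hz']
    | tmul x m =>
      rw [consArg_tmul, map_tmul, LinearEquiv.coe_coe, LinearEquiv.symm_apply_apply,
        LinearMap.id_apply, assoc_tmul]
  rw [bH, if_pos rfl, face0]
  simp only [LinearMap.comp_apply, LinearEquiv.coe_coe, hz, map_tmul, LinearMap.id_apply]

lemma bH_of_pos {n p i : ℕ} (hi : 1 ≤ i) (f : Yc k A M N n p) :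
    bH k A ωM ωN n p i f = f.comp (argFace ωM n i) := by
  rw [bH, if_neg (by omega), argFace]
  split_ifs with h
  · rfl
  · exact congrArg f.comp (TensorProduct.ext' fun x m ↦ rfl)

lemma cH_of_le {n p j : ℕ} (hj : j ≤ p) (f : Yc k A M N n p) :
    cH k A ρM ρN n p j f = (valFace ρN p j).comp f := by
  rw [cH, valFace]
  split_ifs with h
  · rfl
  · rfl

lemma cH_last (n p : ℕ) (f : Yc k A M N n p) :
    cH k A ρM ρN n p (p + 1) f = (snoc k A _ p).toLinearMap.comp
      ((TensorProduct.map f LinearMap.id).comp (coactArg ρM n)) := by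
  have hmap : TensorProduct.map f (μA k A) =
      (TensorProduct.map f LinearMap.id).comp (TensorProduct.map LinearMap.id (μA k A)) := by
    rw [← TensorProduct.map_comp, LinearMap.comp_id, LinearMap.id_comp]
  rw [cH, if_neg (by omega), if_neg (by omega), cofLast, hmap]
  rfl

lemma bH_comp_bH (hM : IsAssocAct ωM) (hN : IsAssocAct ωN) {n p i j : ℕ} (h1 : i < j)
    (h2 : j ≤ n + 2) (f : Yc k A M N n p) :
    bH k A ωM ωN (n + 1) p j (bH k A ωM ωN n p i f) =
      bH k A ωM ωN (n + 1) p i (bH k A ωM ωN n p (j - 1) f) := by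
  rw [bH_of_pos (by omega)]
  rcases Nat.eq_zero_or_pos i with rfl | hi
  · refine consArg_hom_ext fun a z ↦ ?_
    rw [bH_zero_consArg, LinearMap.comp_apply]
    rcases eq_or_ne j 1 with rfl | hj
    · obtain ⟨z, rfl⟩ := (consArg k A M n).surjective z
      induction z using TensorProduct.induction_on with
      | zero => simp only [tmul_zero, map_zero]
      | add z z' hz hz' => simp only [tmul_add, map_add, hz, hz']
      | tmul b z =>
        rw [argFace_one_consArg_consArg, Nat.sub_self, bH_zero_consArg, bH_zero_consArg,
          isAssocAct_ldiag hN p]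
    · rw [argFace_consArg (by omega) h2, bH_zero_consArg, bH_of_pos (by omega),
        LinearMap.comp_apply]
  · rw [bH_of_pos hi, bH_of_pos hi, bH_of_pos (by omega)]
    refine LinearMap.ext fun z ↦ ?_
    exact congrArg f (argFace_comp_argFace hM hi h1 h2 z)

lemma map_comp_id_apply {U V W : Type} [AddCommGroup U] [Module k U] [AddCommGroup V] [Module k V]
    [AddCommGroup W] [Module k W] (g : V →ₗ[k] W) (f : U →ₗ[k] V) (w : U ⊗[k] A) :
    TensorProduct.map (g.comp f) (LinearMap.id : A →ₗ[k] A) w =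
      TensorProduct.map g LinearMap.id (TensorProduct.map f LinearMap.id w) := by
  rw [← LinearMap.comp_apply (TensorProduct.map g _), ← TensorProduct.map_comp, LinearMap.id_comp]

lemma cH_comp_cH (hM : IsCoassoc ρM) (hN : IsCoassoc ρN) {n p i j : ℕ} (h1 : i < j)
    (h2 : j ≤ p + 2) (f : Yc k A M N n p) :
    cH k A ρM ρN n (p + 1) j (cH k A ρM ρN n p i f) =
      cH k A ρM ρN n (p + 1) i (cH k A ρM ρN n p (j - 1) f) := by
  rcases eq_or_ne j (p + 1 + 1) with rfl | hj
  · rw [Nat.add_sub_cancel, cH_last, cH_last, cH_of_le (show i ≤ p + 1 by omega)]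
    refine LinearMap.ext fun z ↦ ?_
    rcases eq_or_ne i (p + 1) with rfl | hi
    · rw [cH_last, valFace, if_neg (by omega)]
      simp only [LinearMap.comp_apply, LinearEquiv.coe_coe]
      rw [← LinearMap.comp_assoc, map_comp_id_apply, isCoassoc_coactArg hM]
      generalize coactArg ρM n z = w
      induction w using TensorProduct.induction_on with
      | zero => simp only [map_zero]
      | add w w' hw hw' => simp only [map_add, hw, hw']
      | tmul y a =>
        rw [map_tmul, map_tmul, comulAt_succ_self]
        simp only [LinearMap.id_apply]
        generalize ΔA k A a = u
        induction u using TensorProduct.induction_on with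
        | zero => simp only [tmul_zero, map_zero]
        | add u u' hu hu' => simp only [tmul_add, map_add, hu, hu']
        | tmul b c => rfl
    · rw [cH_of_le (show i ≤ p by omega)]
      simp only [LinearMap.comp_apply, LinearEquiv.coe_coe]
      rw [valFace_snoc (by omega), map_comp_id_apply]
  · rw [cH_of_le (show i ≤ p by omega), cH_of_le (show j ≤ p + 1 by omega),
      cH_of_le (show j - 1 ≤ p by omega), cH_of_le (show i ≤ p + 1 by omega)]
    refine LinearMap.ext fun z ↦ ?_
    exact valFace_comp_valFace hN h1 (by omega) (f z)

lemma ldiag_succ_snoc (p : ℕ) (a : A) (w : Cd k A N p ⊗[k] A) :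
    ldiag k A ωN (p + 1) (a ⊗ₜ snoc k A _ p w) =
      snoc k A _ p (diagAct (ldiag k A ωN p) (μA k A) (a ⊗ₜ w)) := rfl

lemma cH_comp_bH (hM : ρM.comp ωM = hopfRHS k A ωM ρM) (hN : ρN.comp ωN = hopfRHS k A ωN ρN)
    {n p i j : ℕ} (hj : j ≤ p + 1) (f : Yc k A M N n p) :
    cH k A ρM ρN (n + 1) p j (bH k A ωM ωN n p i f) =
      bH k A ωM ωN n (p + 1) i (cH k A ρM ρN n p j f) := by
  rcases Nat.eq_zero_or_pos i with rfl | hi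
  · refine consArg_hom_ext fun a z ↦ ?_
    rw [bH_zero_consArg]
    rcases eq_or_ne j (p + 1) with rfl | hj'
    · rw [cH_last, cH_last]
      simp only [LinearMap.comp_apply, LinearEquiv.coe_coe]
      have hz := isColinear_consArg (ρM := ρM) n (a ⊗ₜ z)
      rw [LinearEquiv.coe_coe] at hz
      rw [hz, ldiag_succ_snoc, diagAct_tmul, diagCo_tmul]
      congr 1
      generalize ΔA k A a = u
      generalize coactArg ρM n z = w
      induction u using TensorProduct.induction_on with
      | zero => simp only [zero_tmul, map_zero]
      | add u u' hu hu' => simp only [add_tmul, map_add, hu, hu']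
      | tmul b c =>
        induction w using TensorProduct.induction_on with
        | zero => simp only [tmul_zero, map_zero]
        | add w w' hw hw' => simp only [tmul_add, map_add, hw, hw']
        | tmul y d =>
          rw [mulSnd_tmul, map_tmul, map_tmul, map_tmul, tensorTensorTensorComm_tmul, map_tmul,
            LinearEquiv.coe_coe, bH_zero_consArg]
          rfl
    · rw [cH_of_le (by omega), cH_of_le (by omega), LinearMap.comp_apply, bH_zero_consArg,
        isActLinear_valFace hN (by omega), LinearMap.comp_apply]
  · rw [bH_of_pos hi, bH_of_pos hi]
    rcases eq_or_ne j (p + 1) with rfl | hj'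
    · rw [cH_last, cH_last]
      refine LinearMap.ext fun z ↦ ?_
      simp only [LinearMap.comp_apply, LinearEquiv.coe_coe]
      rw [isColinear_argFace hM hi, map_comp_id_apply]
    · rw [cH_of_le (by omega), cH_of_le (by omega), LinearMap.comp_assoc]

lemma bH_add (n p i : ℕ) (f g : Yc k A M N n p) :
    bH k A ωM ωN n p i (f + g) = bH k A ωM ωN n p i f + bH k A ωM ωN n p i g := by
  rcases Nat.eq_zero_or_pos i with rfl | hi
  · refine consArg_hom_ext fun a z ↦ ?_
    simp only [LinearMap.add_apply, bH_zero_consArg, tmul_add, map_add]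
  · simp only [bH_of_pos hi, LinearMap.add_comp]

lemma cH_add {n p j : ℕ} (hj : j ≤ p + 1) (f g : Yc k A M N n p) :
    cH k A ρM ρN n p j (f + g) = cH k A ρM ρN n p j f + cH k A ρM ρN n p j g := by
  rcases eq_or_ne j (p + 1) with rfl | hj'
  · simp only [cH_last, TensorProduct.map_add_left, LinearMap.add_comp, LinearMap.comp_add]
  · simp only [cH_of_le (show j ≤ p by omega), LinearMap.comp_add]

lemma bH_sum (n p i m : ℕ) (g : ℕ → Yc k A M N n p) :
    bH k A ωM ωN n p i (∑ l ∈ Finset.range m, (-1 : ℤ) ^ l • g l) =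
      ∑ l ∈ Finset.range m, (-1 : ℤ) ^ l • bH k A ωM ωN n p i (g l) := by
  have h := map_sum (AddMonoidHom.mk' _ (bH_add (ωM := ωM) (ωN := ωN) n p i))
    (fun l ↦ (-1 : ℤ) ^ l • g l) (Finset.range m)
  simpa only [map_zsmul, AddMonoidHom.mk'_apply] using h

lemma cH_sum {n p j : ℕ} (hj : j ≤ p + 1) (m : ℕ) (g : ℕ → Yc k A M N n p) :
    cH k A ρM ρN n p j (∑ l ∈ Finset.range m, (-1 : ℤ) ^ l • g l) =
      ∑ l ∈ Finset.range m, (-1 : ℤ) ^ l • cH k A ρM ρN n p j (g l) := by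
  have h := map_sum (AddMonoidHom.mk' _ (cH_add (ρM := ρM) (ρN := ρN) hj))
    (fun l ↦ (-1 : ℤ) ^ l • g l) (Finset.range m)
  simpa only [map_zsmul, AddMonoidHom.mk'_apply] using h

end Faces

/-- The alternating double sum of a family satisfying the cosimplicial identities vanishes. -/
lemma alternating_sum_eq_zero {V : Type} [AddCommGroup V] (F : ℕ → ℕ → V) (m : ℕ)
    (h : ∀ i j, i < j → j ≤ m → F j i = F i (j - 1)) :
    ∑ j ∈ Finset.range (m + 1), (-1 : ℤ) ^ j • ∑ i ∈ Finset.range m, (-1 : ℤ) ^ i • F j i = 0 := by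
  simp only [Finset.smul_sum, smul_smul, ← pow_add]
  rw [← Finset.sum_product' (Finset.range (m + 1)) (Finset.range m)
    fun j i ↦ (-1 : ℤ) ^ (j + i) • F j i]
  have hpair (i j : ℕ) (h1 : i < j) (h2 : j ≤ m) :
      (-1 : ℤ) ^ (j + i) • F j i + (-1 : ℤ) ^ (i + (j - 1)) • F i (j - 1) = 0 := by
    rw [h i j h1 h2, ← add_smul, show j + i = i + (j - 1) + 1 by omega, pow_succ]
    simp
  refine Finset.sum_involution
    (fun x _ ↦ if x.2 < x.1 then (x.2, x.1 - 1) else (x.2 + 1, x.1)) ?_ ?_ ?_ ?_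
  · rintro ⟨j, i⟩ hx
    simp only [Finset.mem_product, Finset.mem_range] at hx
    split_ifs with hij
    · exact hpair i j hij (by omega)
    · rw [add_comm]
      exact hpair j (i + 1) (by simp at hij; omega) (by omega)
  · rintro ⟨j, i⟩ hx -
    split_ifs with hij
    · simp only [ne_eq, Prod.mk.injEq]
      simp at hij
      omega
    · simp only [ne_eq, Prod.mk.injEq]
      simp at hij
      omega
  · rintro ⟨j, i⟩ hx
    simp only [Finset.mem_product, Finset.mem_range] at hx
    split_ifs with hij <;> simp only [Finset.mem_product, Finset.mem_range] <;> simp at hij <;>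
      omega
  · rintro ⟨j, i⟩ hx
    rcases lt_or_ge i j with hij | hij
    · simp only [if_pos hij, if_neg (show ¬ j - 1 < i by omega), Prod.mk.injEq, and_true]
      omega
    · simp only [if_neg hij.not_gt, if_pos (Nat.lt_succ_of_le hij), Nat.add_sub_cancel]

/-- For left-right Hopf modules `M, N` over a bialgebra `A`,
`(C^{n,p}(M,N), d_m, d_c)` is a double complex: `d_m² = 0`, `d_c² = 0` and
`d_c ∘ d_m = d_m ∘ d_c`. -/
theorem hopf_bicomplex (k : Type) [Field k] (A : Type) [Ring A] [Bialgebra k A]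
    (M N : Type) [AddCommGroup M] [Module k M] [AddCommGroup N] [Module k N]
    (ωM : A ⊗[k] M →ₗ[k] M) (ρM : M →ₗ[k] M ⊗[k] A)
    (ωN : A ⊗[k] N →ₗ[k] N) (ρN : N →ₗ[k] N ⊗[k] A)
    (hM : IsHopfModule k A ωM ρM) (hN : IsHopfModule k A ωN ρN) :
    (∀ (n p : ℕ) (f : Yc k A M N n p),
      dmH k A ωM ωN (n+1) p (dmH k A ωM ωN n p f) = 0) ∧
    (∀ (n p : ℕ) (f : Yc k A M N n p),
      dcH k A ρM ρN n (p+1) (dcH k A ρM ρN n p f) = 0) ∧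
    (∀ (n p : ℕ) (f : Yc k A M N n p),
      dcH k A ρM ρN (n+1) p (dmH k A ωM ωN n p f) =
        dmH k A ωM ωN n (p+1) (dcH k A ρM ρN n p f)) := by
  obtain ⟨⟨-, hωM⟩, ⟨-, hρM⟩, hM⟩ := hM
  obtain ⟨⟨-, hωN⟩, ⟨-, hρN⟩, hN⟩ := hN
  have hρM : IsCoassoc ρM := LinearMap.congr_fun hρM
  have hρN : IsCoassoc ρN := LinearMap.congr_fun hρN
  refine ⟨fun n p f ↦ ?_, fun n p f ↦ ?_, fun n p f ↦ ?_⟩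
  · simp only [dmH, bH_sum]
    exact alternating_sum_eq_zero
      (fun j i ↦ bH k A ωM ωN (n + 1) p j (bH k A ωM ωN n p i f)) (n + 2)
      fun i j h1 h2 ↦ bH_comp_bH hωM hωN h1 h2 f
  · refine Eq.trans (Finset.sum_congr rfl fun j hj ↦ ?_) (alternating_sum_eq_zero
      (fun j i ↦ cH k A ρM ρN n (p + 1) j (cH k A ρM ρN n p i f)) (p + 2)
      fun i j h1 h2 ↦ cH_comp_cH hρM hρN h1 h2 f)
    rw [dcH, cH_sum (by rw [Finset.mem_range] at hj; omega)]
  · simp only [dmH, dcH, bH_sum, Finset.smul_sum]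
    rw [Finset.sum_comm (s := Finset.range (n + 2))]
    refine Finset.sum_congr rfl fun j hj ↦ ?_
    have hj : j ≤ p + 1 := by rw [Finset.mem_range] at hj; omega
    rw [cH_sum hj, Finset.smul_sum]
    refine Finset.sum_congr rfl fun i _ ↦ ?_
    rw [cH_comp_bH hM hN hj, smul_comm]

end PS
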